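/- In 2×2×3 Abalone, if Black occupies both middle spaces e and f and Black's pieces form the triangle subconfiguration (marbles on e, f, and b, or on e, f, and i), and Gray's marbles all occupy the three spaces not threatened by the triangle, then the player whose turn it is can be forced: Black moving from this position (via the in-line move breaking the triangle toward a corner, followed by a fork) wins. -/

import Mathlib

/-- An abstract two-player game with perfect information and alternating moves.
`true` denotes Left (Black) and `false` denotes Right (Gray). -/
structure AGame (P : Type*) where
  /-- `move pl p q` : player `pl` has a legal move from position `p` to position `q`. -/
  move : Bool → P → P → Prop
  /-- `win pl p` : the position `p` is a terminal win for player `pl`. -/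
  win : Bool → P → Prop

namespace AGame

variable {P : Type*}

/-- `FW G pl turn p` : player `pl` can force a win (in finitely many moves)
from position `p` when it is `turn`'s move. -/
inductive FW (G : AGame P) (pl : Bool) : Bool → P → Prop
  | terminal (turn : Bool) (p : P) : G.win pl p → FW G pl turn p
  | self (p q : P) : ¬ G.win (!pl) p → G.move pl p q → FW G pl (!pl) q → FW G pl pl p
  | opp (p : P) : ¬ G.win (!pl) p → (∃ q, G.move (!pl) p q) →
      (∀ q, G.move (!pl) p q → FW G pl pl q) → FW G pl (!pl) p

/-- Outcome class `L` : Left (Black) always wins, whoever moves first. -/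
def OutL (G : AGame P) (p : P) : Prop := G.FW true true p ∧ G.FW true false p

/-- Outcome class `R` : Right (Gray) always wins, whoever moves first. -/
def OutR (G : AGame P) (p : P) : Prop := G.FW false false p ∧ G.FW false true p

/-- Outcome class `N` : whoever moves next wins. -/
def OutN (G : AGame P) (p : P) : Prop := G.FW true true p ∧ G.FW false false p

/-- Outcome class `D` : neither player can force a win (optimal play is an infinite draw). -/
def OutD (G : AGame P) (p : P) : Prop :=
  ¬ G.FW true true p ∧ ¬ G.FW true false p ∧ ¬ G.FW false true p ∧ ¬ G.FW false false p

/-- Outcome class `N̂` : Left wins moving first, and the game is a draw if Right moves first. -/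
def OutNhat (G : AGame P) (p : P) : Prop :=
  G.FW true true p ∧ ¬ G.FW true false p ∧ ¬ G.FW false false p

/-- Outcome class `Ň` : Right wins moving first, and the game is a draw if Left moves first. -/
def OutNcheck (G : AGame P) (p : P) : Prop :=
  G.FW false false p ∧ ¬ G.FW false true p ∧ ¬ G.FW true true p

end AGame

namespace Abalone

/-- A board cell, in axial hexagonal coordinates `(q, r)` where `q` is the column. -/
abbrev Cell : Type := ℤ × ℤ

/-- A constellation: each cell carries a black marble (`some true`),
a gray marble (`some false`), or is empty (`none`). -/
abbrev Pos : Type := Cell → Option Bool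

/-- The six unit directions of the hexagonal grid. -/
def dirs : List Cell := [(1, 0), (0, 1), (-1, 1), (-1, 0), (0, -1), (1, -1)]

/-- Add a direction to a cell. -/
def addc (x d : Cell) : Cell := (x.1 + d.1, x.2 + d.2)

/-- The cell `n` steps from `x` in direction `d`. -/
def stepc (x : Cell) (n : ℕ) (d : Cell) : Cell := (x.1 + (n : ℤ) * d.1, x.2 + (n : ℤ) * d.2)

/-- The opposite direction. -/
def negd (d : Cell) : Cell := (-d.1, -d.2)

open Classical in
/-- The result of shifting the line of `len` marbles starting one step after `x`
(in direction `d`, with the marble at `x` itself moving into the vacated space):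
cell `x` is vacated, each cell `x + i·d` (`1 ≤ i ≤ len`) receives the content of its
predecessor, and marbles shifted off the board are removed. -/
noncomputable def shiftResult (board : Finset Cell) (c : Pos) (x d : Cell) (len : ℕ) : Pos :=
  fun y =>
    if y ∉ board then none
    else if y = x then none
    else if ∃ i : ℕ, 1 ≤ i ∧ i ≤ len ∧ y = stepc x i d then c (addc y (negd d))
    else c y

/-- In-line movement (including sumito pushes): player `pl` moves a line of `k` of their
own contiguous marbles (`1 ≤ k ≤ maxG`) one step in the line's direction `d`, possibly
pushing a strictly shorter opposing line of `m < k` marbles, the leading opposing marble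
being pushed either onto an empty board cell or off the board. -/
def InlineMove (board : Finset Cell) (maxG : ℕ) (pl : Bool) (c c' : Pos) : Prop :=
  ∃ x d, d ∈ dirs ∧ ∃ k m : ℕ,
    1 ≤ k ∧ k ≤ maxG ∧ m < k ∧
    (∀ i < k, stepc x i d ∈ board ∧ c (stepc x i d) = some pl) ∧
    (∀ i, k ≤ i → i < k + m → stepc x i d ∈ board ∧ c (stepc x i d) = some (!pl)) ∧
    ((m = 0 ∧ stepc x k d ∈ board ∧ c (stepc x k d) = none) ∨
      (1 ≤ m ∧ (stepc x (k + m) d ∉ board ∨ c (stepc x (k + m) d) = none))) ∧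
    c' = shiftResult board c x d (k + m)

open Classical in
/-- The result of a broadside move: the `k` marbles at `x + i·d` (`i < k`) each move
one step in direction `e`. -/
noncomputable def broadResult (c : Pos) (pl : Bool) (x d e : Cell) (k : ℕ) : Pos :=
  fun y =>
    if ∃ i < k, y = stepc x i d then none
    else if ∃ i < k, y = addc (stepc x i d) e then some pl
    else c y

/-- Broadside movement: player `pl` moves a line of `k` of their own contiguous marbles
(`1 ≤ k ≤ maxG`, the line in direction `d`) one step in a direction `e` not along the
line, each marble landing on an empty board cell. -/
def BroadsideMove (board : Finset Cell) (maxG : ℕ) (pl : Bool) (c c' : Pos) : Prop :=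
  ∃ x d e, d ∈ dirs ∧ e ∈ dirs ∧ e ≠ d ∧ e ≠ negd d ∧ ∃ k : ℕ,
    1 ≤ k ∧ k ≤ maxG ∧
    (∀ i < k, stepc x i d ∈ board ∧ c (stepc x i d) = some pl) ∧
    (∀ i < k, addc (stepc x i d) e ∈ board ∧ c (addc (stepc x i d) e) = none) ∧
    c' = broadResult c pl x d e k

/-- A legal Abalone move for player `pl`. -/
def Move (board : Finset Cell) (maxG : ℕ) (pl : Bool) (c c' : Pos) : Prop :=
  InlineMove board maxG pl c c' ∨ BroadsideMove board maxG pl c c'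

/-- The number of marbles of player `pl` on the board. -/
def countM (board : Finset Cell) (pl : Bool) (c : Pos) : ℕ :=
  (board.filter (fun y => c y = some pl)).card

/-- Player `pl` has won: the opponent has fewer than `n` marbles left,
i.e. at least one opposing marble has been pushed off the board. -/
def Wins (board : Finset Cell) (n : ℕ) (pl : Bool) (c : Pos) : Prop :=
  countM board (!pl) c < n

/-- The negative of a constellation: swap black and gray marbles. -/
def negP (c : Pos) : Pos := fun y => (c y).map (fun b => !b)

end Abalone

namespace Abalone

/-! ### The 2×2×3 Abalone board

A hexagonal grid of 10 cells with columns of sizes 3, 4, 3, labelled as in the paper: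
`a, b, c` the left column (bottom to top), `d, e, f, g` the middle column (bottom to
top, with `e, f` the two central spaces), and `h, i, j` the right column (bottom to
top). Each player has 3 marbles, may move 1–3 contiguous marbles, a strictly longer
line pushes a shorter opposing line, and a player wins by ejecting one opposing
marble. -/

def ca : Cell := (-1, 2)
def cb : Cell := (-1, 1)
def cc : Cell := (-1, 0)
def cd : Cell := (0, 2)
def ce : Cell := (0, 1)
def cf : Cell := (0, 0)
def cg : Cell := (0, -1)
def ch : Cell := (1, 1)
def ci : Cell := (1, 0)
def cj : Cell := (1, -1)

def board223 : Finset Cell := {ca, cb, cc, cd, ce, cf, cg, ch, ci, cj}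

/-- 2×2×3 Abalone as a game: moves of 1–3 contiguous marbles, win by
reducing the opponent to fewer than 3 marbles. -/
def G223 : AGame Pos :=
  { move := Move board223 3
    win := Wins board223 3 }

/-- The constellation with black marbles on `b1, b2, b3` and gray marbles
on `g1, g2, g3`. -/
def mk3 (b1 b2 b3 g1 g2 g3 : Cell) : Pos := fun y =>
  if y = b1 ∨ y = b2 ∨ y = b3 then some true
  else if y = g1 ∨ y = g2 ∨ y = g3 then some false
  else none

/-- The boards `C0`–`C8` of the paper (Figure 8). -/
def C0 : Pos := mk3 cc cg cj ca cd ch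
def C1 : Pos := mk3 cc cf cg ca cd ch
def C2 : Pos := mk3 cc cf cg ca cd ce
def C3 : Pos := mk3 cc cf cg ce cd ch
def C4 : Pos := mk3 cb cf cg ca cd ce
def C5 : Pos := mk3 cc cb cg ca cd ce
def C6 : Pos := mk3 cb cf cg ce cd ci
def C7 : Pos := mk3 cb cc cg ci cd ce
def C8 : Pos := mk3 cc cf cg ci cd ce

/-- A valid 2×2×3 constellation: all marbles on the board,
3 black and 3 gray marbles. -/
def Valid223 (c : Pos) : Prop :=
  (∀ y, y ∉ board223 → c y = none) ∧
  countM board223 true c = 3 ∧ countM board223 false c = 3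

/-- `c` contains (up to the symmetries of the board) the neutral subconfiguration:
two Gray marbles in a corner column pair threaten an adjacent Black marble in the
same column (e.g. Gray on `a` and `b` threatening Black on `c`). -/
def ContainsNeutral (c : Pos) : Prop :=
  (c ca = some false ∧ c cb = some false ∧ c cc = some true) ∨
  (c cb = some false ∧ c cc = some false ∧ c ca = some true) ∨
  (c ch = some false ∧ c ci = some false ∧ c cj = some true) ∨
  (c ci = some false ∧ c cj = some false ∧ c ch = some true)

end Abalone

namespace Abalone

/-- Black's triangle subconfiguration on `e, f, b` with Gray's three marbles on the
three spaces `a, c, i` not threatened by the triangle. -/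
def triangleB : Pos := mk3 cb ce cf ca cc ci

/-- The mirror-image triangle subconfiguration on `e, f, i` with Gray's marbles on
the corresponding safe spaces `b, h, j`. -/
def triangleI : Pos := mk3 ce cf ci cb ch cj

end Abalone

namespace Abalone

/-- The cells of the 2×2×3 board, as a list. -/
def cells : List Cell := [ca, cb, cc, cd, ce, cf, cg, ch, ci, cj]

theorem toFinset_cells : cells.toFinset = board223 := by
  decide +kernel

theorem mem_cells {x : Cell} : x ∈ cells ↔ x ∈ board223 := by
  rw [← toFinset_cells, List.mem_toFinset]

/-- Boolean test for the 2×2×3 board, by inequalities between hexagonal coordinates. -/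
def onBoard (x : Cell) : Bool :=
  decide (-1 ≤ x.1) && decide (x.1 ≤ 1) && decide (-1 ≤ x.2) && decide (x.2 ≤ 2) &&
    decide (-1 ≤ x.1 + x.2) && decide (x.1 + x.2 ≤ 2)

theorem mem_board223 {x : Cell} : x ∈ board223 ↔ onBoard x = true := by
  obtain ⟨q, r⟩ := x
  simp only [board223, onBoard, ca, cb, cc, cd, ce, cf, cg, ch, ci, cj, Finset.mem_insert,
    Finset.mem_singleton, Prod.mk.injEq, Bool.and_eq_true, decide_eq_true_eq]
  omega

/-- Computable version of `shiftResult` on the 2×2×3 board. -/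
def shift (c : Pos) (x d : Cell) (len : ℕ) : Pos := fun y =>
  bif !onBoard y then none
  else bif y == x then none
  else bif (List.range len).any fun i => y == stepc x (i + 1) d then c (addc y (negd d))
  else c y

theorem shiftResult_eq_shift (c : Pos) (x d : Cell) (len : ℕ) :
    shiftResult board223 c x d len = shift c x d len := by
  funext y
  have h : (∃ i, 1 ≤ i ∧ i ≤ len ∧ y = stepc x i d) ↔ ∃ i < len, y = stepc x (i + 1) d := by
    constructor
    · rintro ⟨i, h1, h2, hy⟩
      exact ⟨i - 1, by omega, by rwa [Nat.sub_add_cancel h1]⟩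
    · rintro ⟨i, hi, hy⟩
      exact ⟨i + 1, by omega, hi, hy⟩
  simp [shiftResult, shift, h, mem_board223, cond_eq_ite]

/-- Computable version of `broadResult`. -/
def broad (c : Pos) (pl : Bool) (x d e : Cell) (k : ℕ) : Pos := fun y =>
  bif (List.range k).any fun i => y == stepc x i d then none
  else bif (List.range k).any fun i => y == addc (stepc x i d) e then some pl
  else c y

theorem broadResult_eq_broad (c : Pos) (pl : Bool) (x d e : Cell) (k : ℕ) :
    broadResult c pl x d e k = broad c pl x d e k := by
  funext y
  simp [broadResult, broad, cond_eq_ite]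

/-- The line of `k` marbles of `pl` starting at `x` may move in direction `d`,
pushing `m` opposing marbles. -/
def inlineLegal (pl : Bool) (c : Pos) (x d : Cell) (k m : ℕ) : Bool :=
  ((List.range k).all fun i => onBoard (stepc x i d) && c (stepc x i d) == some pl) &&
    ((List.range m).all fun j =>
      onBoard (stepc x (k + j) d) && c (stepc x (k + j) d) == some (!pl)) &&
    (bif m == 0 then onBoard (stepc x k d) && c (stepc x k d) == none
      else !onBoard (stepc x (k + m) d) || c (stepc x (k + m) d) == none)

/-- The line of `k` marbles of `pl` starting at `x` in direction `d` may move broadside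
in direction `e`. -/
def broadLegal (pl : Bool) (c : Pos) (x d e : Cell) (k : ℕ) : Bool :=
  ((List.range k).all fun i => onBoard (stepc x i d) && c (stepc x i d) == some pl) &&
    e != d && e != negd d &&
    (List.range k).all fun i =>
      onBoard (addc (stepc x i d) e) && c (addc (stepc x i d) e) == none

theorem stepc_zero (x d : Cell) : stepc x 0 d = x := by
  simp [stepc]

theorem inlineLegal_iff {pl : Bool} {c : Pos} {x d : Cell} {k m : ℕ} :
    inlineLegal pl c x d k m = true ↔
      (∀ i < k, stepc x i d ∈ board223 ∧ c (stepc x i d) = some pl) ∧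
      (∀ i, k ≤ i → i < k + m → stepc x i d ∈ board223 ∧ c (stepc x i d) = some (!pl)) ∧
      ((m = 0 ∧ stepc x k d ∈ board223 ∧ c (stepc x k d) = none) ∨
        (1 ≤ m ∧ (stepc x (k + m) d ∉ board223 ∨ c (stepc x (k + m) d) = none))) := by
  have hpush (P : ℕ → Prop) : (∀ i, k ≤ i → i < k + m → P i) ↔ ∀ j < m, P (k + j) := by
    constructor
    · exact fun h j hj => h _ (by omega) (by omega)
    · intro h i hki hi
      obtain ⟨j, rfl⟩ := Nat.exists_eq_add_of_le hki
      exact h j (by omega)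
  rw [hpush]
  rcases Nat.eq_zero_or_pos m with rfl | hm
  · simp [inlineLegal, mem_board223]
  · simp [inlineLegal, mem_board223, cond_eq_ite, hm.ne', Nat.one_le_iff_ne_zero, and_assoc]

theorem inlineMove_iff {pl : Bool} {c c' : Pos} :
    InlineMove board223 3 pl c c' ↔ ∃ x d, d ∈ dirs ∧ ∃ k m, 1 ≤ k ∧ k ≤ 3 ∧ m < k ∧
      inlineLegal pl c x d k m = true ∧ c' = shift c x d (k + m) := by
  simp only [InlineMove, shiftResult_eq_shift, inlineLegal_iff, and_assoc]

theorem broadsideMove_iff {pl : Bool} {c c' : Pos} :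
    BroadsideMove board223 3 pl c c' ↔ ∃ x d e, d ∈ dirs ∧ e ∈ dirs ∧ ∃ k, 1 ≤ k ∧ k ≤ 3 ∧
      broadLegal pl c x d e k = true ∧ c' = broad c pl x d e k := by
  simp only [BroadsideMove, broadResult_eq_broad, broadLegal, mem_board223, Bool.and_eq_true,
    List.all_eq_true, List.mem_range, beq_iff_eq, bne_iff_ne]
  constructor
  · rintro ⟨x, d, e, hd, he, hne, hne', k, h1, h3, hown, hfree, rfl⟩
    exact ⟨x, d, e, hd, he, k, h1, h3, ⟨⟨⟨hown, hne⟩, hne'⟩, hfree⟩, rfl⟩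
  · rintro ⟨x, d, e, hd, he, k, h1, h3, ⟨⟨⟨hown, hne⟩, hne'⟩, hfree⟩, rfl⟩
    exact ⟨x, d, e, hd, he, hne, hne', k, h1, h3, hown, hfree, rfl⟩

/-- All marbles of `c` are on the 2×2×3 board. -/
def Supported (c : Pos) : Prop := ∀ y ∉ board223, c y = none

theorem supported_mk3 {b₁ b₂ b₃ g₁ g₂ g₃ : Cell}
    (h : {b₁, b₂, b₃, g₁, g₂, g₃} ⊆ board223) : Supported (mk3 b₁ b₂ b₃ g₁ g₂ g₃) := by
  simp only [Finset.insert_subset_iff, Finset.singleton_subset_iff] at h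
  intro y hy
  have hne {z : Cell} (hz : z ∈ board223) : y ≠ z := fun e => hy (e ▸ hz)
  simp [mk3, hne h.1, hne h.2.1, hne h.2.2.1, hne h.2.2.2.1, hne h.2.2.2.2.1, hne h.2.2.2.2.2]

theorem Supported.of_move {pl : Bool} {c c' : Pos} (hs : Supported c)
    (h : G223.move pl c c') : Supported c' := by
  intro y hy
  rcases h with ⟨x, d, -, k, m, -, -, -, -, -, -, rfl⟩ |
    ⟨x, d, e, -, -, -, -, k, -, -, -, hfree, rfl⟩
  · simp [shiftResult, hy]
  · have hy' : ¬ ∃ i < k, y = addc (stepc x i d) e := by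
      rintro ⟨i, hi, rfl⟩
      exact hy (hfree i hi).1
    simp [broadResult, hy', hs y hy]

theorem Supported.broad_one {pl : Bool} {c : Pos} {x d e : Cell} (hs : Supported c)
    (hl : broadLegal pl c x d e 1 = true) (he : e ∈ dirs) :
    inlineLegal pl c x e 1 0 = true ∧ broad c pl x d e 1 = shift c x e 1 := by
  have hstep : stepc x 1 e = addc x e := by simp [stepc, addc]
  have hback : addc (addc x e) (negd e) = x := by simp [addc, negd]
  have hne : addc x e ≠ x := by
    simp only [addc, ne_eq, Prod.ext_iff]
    simp only [dirs, List.mem_cons, List.not_mem_nil, or_false] at he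
    rcases he with rfl | rfl | rfl | rfl | rfl | rfl <;> simp
  simp only [broadLegal, List.range_one, List.all_cons, List.all_nil, stepc_zero, Bool.and_true,
    Bool.and_eq_true, beq_iff_eq] at hl
  obtain ⟨⟨⟨⟨hx, hcx⟩, -⟩, -⟩, hxe, hcxe⟩ := hl
  refine ⟨by simp [inlineLegal, stepc_zero, hstep, hx, hcx, hxe, hcxe], ?_⟩
  funext y
  by_cases hy : y = x
  · simp [broad, shift, stepc_zero, hy]
  by_cases hye : y = addc x e
  · subst hye
    simp [broad, shift, stepc_zero, hstep, hback, hne, hxe, hcx, cond_eq_ite]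
  · by_cases hb : onBoard y = true
    · simp [broad, shift, stepc_zero, hstep, hy, hye, hb, cond_eq_ite]
    · simp [broad, shift, stepc_zero, hstep, hye, hb, cond_eq_ite, hs y (mt mem_board223.1 hb)]

/-- Boolean version of `Wins` on the 2×2×3 board. -/
def wins (pl : Bool) (c : Pos) : Bool :=
  Nat.blt (cells.countP fun y => c y == some (!pl)) 3

theorem wins_iff {pl : Bool} {c : Pos} : wins pl c = true ↔ G223.win pl c := by
  have hnd : cells.Nodup := by decide +kernel
  simp only [wins, G223, Wins, countM, ← toFinset_cells, hnd.card_eq_countP, Nat.blt_eq,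
    beq_eq_decide]

/-- Some in-line move of `pl` from `c` leads to a position satisfying `Q`. -/
def someInline (pl : Bool) (c : Pos) (Q : Pos → Bool) : Bool :=
  cells.any fun x => c x == some pl && dirs.any fun d => [1, 2, 3].any fun k =>
    (List.range k).any fun m => inlineLegal pl c x d k m && Q (shift c x d (k + m))

/-- Every move of `pl` from `c` leads to a position satisfying `Q`; broadside moves of a
single marble are omitted, being in-line moves as well. -/
def allMoves (pl : Bool) (c : Pos) (Q : Pos → Bool) : Bool :=
  cells.all fun x => c x != some pl || dirs.all fun d => [1, 2, 3].all fun k =>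
    ((List.range k).all fun m => !inlineLegal pl c x d k m || Q (shift c x d (k + m))) &&
    (k == 1 || dirs.all fun e => !broadLegal pl c x d e k || Q (broad c pl x d e k))

theorem exists_move_of_someInline {pl : Bool} {c : Pos} {Q : Pos → Bool}
    (h : someInline pl c Q = true) : ∃ c', G223.move pl c c' ∧ Q c' = true := by
  simp only [someInline, List.any_eq_true, Bool.and_eq_true, List.mem_range] at h
  obtain ⟨x, -, -, d, hd, k, hk, m, hm, hl, hQ⟩ := h
  have hk' : 1 ≤ k ∧ k ≤ 3 := by
    simp only [List.mem_cons, List.not_mem_nil, or_false] at hk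
    omega
  exact ⟨_, Or.inl (inlineMove_iff.2 ⟨x, d, hd, k, m, hk'.1, hk'.2, hm, hl, rfl⟩), hQ⟩

theorem of_allMoves_of_move {pl : Bool} {c c' : Pos} {Q : Pos → Bool}
    (h : allMoves pl c Q = true) (hs : Supported c) (hc : G223.move pl c c') : Q c' = true := by
  simp only [allMoves, List.all_eq_true, Bool.and_eq_true, Bool.or_eq_true, List.mem_range,
    bne_iff_ne, ne_eq, Bool.not_eq_true', ← Bool.not_eq_true, beq_iff_eq, ← imp_iff_not_or] at h
  have hk {k : ℕ} (h1 : 1 ≤ k) (h3 : k ≤ 3) : k ∈ [1, 2, 3] := by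
    interval_cases k <;> simp
  have start {x d : Cell} {k : ℕ} (h1 : 1 ≤ k)
      (hown : ∀ i < k, stepc x i d ∈ board223 ∧ c (stepc x i d) = some pl) :
      x ∈ cells ∧ c x = some pl := by
    simpa only [stepc_zero, mem_cells] using hown 0 h1
  rcases hc with hc | hc
  · obtain ⟨x, d, hd, k, m, h1, h3, hm, hl, rfl⟩ := inlineMove_iff.1 hc
    obtain ⟨hx, hcx⟩ := start h1 (inlineLegal_iff.1 hl).1
    exact (h x hx hcx d hd k (hk h1 h3)).1 m hm hl
  · obtain ⟨x, d, e, hd, he, k, h1, h3, hl, rfl⟩ := broadsideMove_iff.1 hc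
    obtain ⟨hx, hcx⟩ := start h1 (d := d) fun i hi => by
      have := hl
      simp only [broadLegal, Bool.and_eq_true, List.all_eq_true, List.mem_range,
        beq_iff_eq] at this
      exact (this.1.1.1 i hi).imp_left mem_board223.2
    rcases (h x hx hcx d hd k (hk h1 h3)).2 with rfl | hbroad
    · obtain ⟨hl', heq⟩ := hs.broad_one hl he
      rw [heq]
      exact (h x hx hcx e he 1 (hk le_rfl h3)).1 0 one_pos hl'
    · exact hbroad e he hl

/-- Black, to move at `c`, forces a win within `n` of Black's own moves, all of them in-line. -/
def blackForces : ℕ → Pos → Bool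
  | 0, _ => false
  | n + 1, c => !wins false c && (someInline true c (wins true) ||
      someInline true c fun p => !wins false p &&
        someInline false p (fun _ => true) && allMoves false p (blackForces n))

theorem forcedWin_of_blackForces {n : ℕ} {c : Pos} (hs : Supported c)
    (h : blackForces n c = true) :
    G223.FW true true c := by
  induction n generalizing c with
  | zero => exact absurd h Bool.false_ne_true
  | succ n ih =>
    simp only [blackForces, Bool.and_eq_true, Bool.or_eq_true, Bool.not_eq_true',
      ← Bool.not_eq_true, wins_iff] at h
    obtain ⟨hc, h | h⟩ := h
    · obtain ⟨p, hmove, hp⟩ := exists_move_of_someInline h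
      exact .self c p hc hmove (.terminal _ _ (wins_iff.1 hp))
    · obtain ⟨p, hmove, hp⟩ := exists_move_of_someInline h
      simp only [Bool.and_eq_true, Bool.not_eq_true', ← Bool.not_eq_true, wins_iff] at hp
      obtain ⟨⟨hp, hreply⟩, hall⟩ := hp
      obtain ⟨q, hq, -⟩ := exists_move_of_someInline hreply
      exact .self c p hc hmove
        (.opp p hp ⟨q, hq⟩ fun q hq =>
          ih ((hs.of_move hmove).of_move hq) (of_allMoves_of_move hall (hs.of_move hmove) hq))

end Abalone

open Abalone AGame in
/-- in 2×2×3 Abalone, if Black occupies both middle spaces `e` and `f`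
together with `b` (or with `i`), forming the triangle subconfiguration, and Gray's
three marbles occupy the three spaces not threatened by the triangle, then Black,
moving from this position (via the in-line move breaking the triangle toward a
corner, followed by a fork), can force a win. -/
theorem triangle_black_to_move_wins :
    G223.FW true true triangleB ∧ G223.FW true true triangleI := by
  have hB : blackForces 3 triangleB = true := by decide +kernel
  have hI : blackForces 3 triangleI = true := by decide +kernel
  exact ⟨forcedWin_of_blackForces (supported_mk3 (by decide)) hB,
    forcedWin_of_blackForces (supported_mk3 (by decide)) hI⟩
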